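/- Let m < n, λ_1,...,λ_m ∈ ℝ, F(x) = e^{-x²/2}∏_{j=1}^m(x-λ_j), c > 0 with 2nc² < 1, and B = ∪_{i=1}^m (λ_i, λ_i + c)² ⊂ ℝ². Then ∫_B |x₁-x₂||F(x₁)||F(x₂)| dx₁dx₂ ≤ n c⁴ ∫_ℝ |F(x)|² dx. -/

import Mathlib

open MeasureTheory
open Polynomial in
theorem aux_int (p : ℝ[X]) : Integrable (fun x : ℝ => p.eval x * Real.exp (-x^2)) := by
  induction p using Polynomial.induction_on' with
  | add p q hp hq =>
    simp only [eval_add, add_mul]; exact hp.add hq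
  | monomial n a =>
    simp only [eval_monomial, mul_assoc]
    apply Integrable.const_mul
    have := integrable_rpow_mul_exp_neg_mul_sq (b := 1) one_pos (s := (n:ℝ)) (by have : (0:ℝ) ≤ n := n.cast_nonneg
                                                                                 linarith)
    simpa [Real.rpow_natCast] using this

open Polynomial in
noncomputable def auxE (p : ℝ[X]) : ℝ := ∫ x : ℝ, p.eval x * Real.exp (-x^2)

open Polynomial in
theorem auxE_add (p q : ℝ[X]) : auxE (p + q) = auxE p + auxE q := by
  unfold auxE
  rw [← integral_add (aux_int p) (aux_int q)]
  simp only [eval_add, add_mul]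

open Polynomial in
theorem auxE_C (a : ℝ) (q : ℝ[X]) : auxE (C a * q) = a * auxE q := by
  unfold auxE
  rw [← integral_const_mul]
  simp only [eval_mul, eval_C, mul_assoc]

open Polynomial in
theorem auxE_sq (p : ℝ[X]) : 0 ≤ auxE (p * p) := by
  unfold auxE
  apply integral_nonneg
  intro x
  simp only [eval_mul, Pi.zero_apply]
  exact mul_nonneg (mul_self_nonneg _) (Real.exp_pos _).le

open Polynomial in
theorem auxE_der (p : ℝ[X]) : auxE (derivative p) = 2 * auxE (X * p) := by
  have h : ∫ x : ℝ, (derivative p + C (-2) * (X * p)).eval x * Real.exp (-x^2) = 0 := by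
    apply integral_eq_zero_of_hasDerivAt_of_integrable (f := fun x => p.eval x * Real.exp (-x^2))
    · intro x
      have h1 := p.hasDerivAt x
      have h2 : HasDerivAt (fun x : ℝ => Real.exp (-x^2)) (Real.exp (-x^2) * (-(2 * x))) x := by
        simpa using ((hasDerivAt_pow 2 x).neg).exp
      refine (h1.mul h2).congr_deriv ?_
      simp only [eval_add, eval_mul, eval_C, eval_X]; ring
    · exact aux_int _
    · exact aux_int _
  have h' : auxE (derivative p + C (-2) * (X * p)) = 0 := h
  rw [auxE_add, auxE_C] at h'
  linarith

open Polynomial in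
theorem aux_markov (m : ℕ) : ∀ P : ℝ[X], P.natDegree ≤ m →
    auxE (derivative P * derivative P) ≤ 2 * m * auxE (P * P) := by
  induction m with
  | zero =>
    intro P hP
    rw [derivative_of_natDegree_zero (by omega)]
    simp [auxE]
  | succ m ih =>
    intro P hP
    set Q := derivative P with hQ
    have hd : Q.natDegree ≤ m := by
      have : Q.natDegree ≤ P.natDegree - 1 := natDegree_derivative_le P
      omega
    have h1 := ih Q hd
    set Q' := derivative Q with hQ'
    have e1 := auxE_der (P * Q)
    have e2 := auxE_der (X * (Q * Q))
    simp only [derivative_mul, ← hQ, ← hQ', derivative_X] at e1 e2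
    have s := auxE_sq (C (2 * (m+1):ℝ) * P + C (-2) * (X * Q) + Q')
    set t : ℝ := 2 * (m+1) with ht
    have x1 : (C t * P + C (-2) * (X * Q) + Q') * (C t * P + C (-2) * (X * Q) + Q')
      = C (t^2) * (P * P) + (C (-4*t) * (X * (P * Q)) + (C (2*t) * (P * Q') + (C 4 * (X * (X * (Q * Q)))
        + (C (-4) * (X * (Q * Q')) + Q' * Q')))) := by
      simp only [map_mul, map_neg, map_pow, map_ofNat]; ring
    have x2 : 1 * (Q * Q) + X * (Q' * Q + Q * Q') = Q * Q + C 2 * (X * (Q * Q')) := by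
      simp only [map_ofNat]; ring
    rw [x1] at s
    rw [x2] at e2
    simp only [auxE_add, auxE_C] at s e1 e2
    push_cast
    have tp : 0 < t := by positivity
    have : 0 ≤ t * (t * auxE (P * P) - auxE (Q * Q)) := by
      have : t = 2 * m + 2 := by rw [ht]; ring
      have k : t * auxE (Q*Q) = 2 * m * auxE (Q*Q) + 2 * auxE (Q*Q) := by rw [this]; ring
      have k2 : t * auxE (Q*Q) + t * auxE (P * Q') = t * (2 * auxE (X * (P * Q))) := by rw [← e1]; ring
      nlinarith
    have := nonneg_of_mul_nonneg_right this tp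
    linarith

open Polynomial in
theorem aux_markov2 (m : ℕ) (P : ℝ[X]) (hP : P.natDegree ≤ m) :
    auxE ((derivative P + C (-1) * (X * P)) * (derivative P + C (-1) * (X * P))) ≤ (2 * m + 1) * auxE (P * P) := by
  have h1 := aux_markov m P hP
  have e2 := auxE_der (X * (P * P))
  have s := auxE_sq (X * P)
  simp only [derivative_mul, derivative_X] at e2
  set Q := derivative P
  have x1 : (Q + C (-1) * (X * P)) * (Q + C (-1) * (X * P)) = Q * Q + (C (-2) * (X * (P * Q)) + X * (X * (P * P))) := by
    simp only [map_neg, map_one, map_ofNat]; ring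
  have x2 : 1 * (P * P) + X * (Q * P + P * Q) = P * P + C 2 * (X * (P * Q)) := by
      simp only [map_ofNat]; ring
  have x3 : X * P * (X * P) = X * (X * (P * P)) := by ring
  rw [x1]
  rw [x2] at e2
  rw [x3] at s
  simp only [auxE_add, auxE_C] at *
  linarith

theorem aux_cs (f g : ℝ → ℝ) (hg : Continuous g) (hf : ∀ x, HasDerivAt f (g x) x) (a x : ℝ) (hax : a < x)
    (ha : f a = 0) : f x ^ 2 ≤ (x - a) * ∫ y in a..x, g y ^ 2 := by
  have h1 : ∫ y in a..x, g y = f x := by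
    rw [intervalIntegral.integral_eq_sub_of_hasDerivAt (fun y _ => hf y) (hg.intervalIntegrable _ _), ha, sub_zero]
  have h2 : 0 ≤ ∫ y in a..x, ((x - a) * g y - f x) ^ 2 :=
    intervalIntegral.integral_nonneg hax.le (fun _ _ => sq_nonneg _)
  have h3 : ∫ y in a..x, ((x - a) * g y - f x) ^ 2 =
      (x - a)^2 * (∫ y in a..x, g y ^ 2) - 2 * (x - a) * f x * (∫ y in a..x, g y) + (x - a) * f x ^ 2 := by
    have : ∀ y, ((x - a) * g y - f x) ^ 2 = (x - a)^2 * g y ^ 2 - 2 * (x - a) * f x * g y + f x ^ 2 := by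
      intro y; ring
    simp only [this]
    rw [intervalIntegral.integral_add, intervalIntegral.integral_sub, intervalIntegral.integral_const_mul,
      intervalIntegral.integral_const_mul, intervalIntegral.integral_const, smul_eq_mul]
    all_goals apply Continuous.intervalIntegrable; fun_prop
  rw [h3, h1] at h2
  have : 0 ≤ (x - a) * ((x - a) * (∫ y in a..x, g y ^ 2) - f x ^ 2) := by nlinarith
  have := nonneg_of_mul_nonneg_right this (sub_pos.2 hax)
  linarith

theorem aux_poinc (f g : ℝ → ℝ) (hg : Continuous g) (hf : ∀ x, HasDerivAt f (g x) x) (a d c : ℝ) 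
    (had : a ≤ d) (hd : d ≤ a + c) (ha : f a = 0) :
    ∫ x in Set.Ioc a d, f x ^ 2 ≤ c^2 / 2 * ∫ x in Set.Ioc a d, g x ^ 2 := by
  have hfc : Continuous f := continuous_iff_continuousAt.2 fun x => (hf x).continuousAt
  rw [← intervalIntegral.integral_of_le had, ← intervalIntegral.integral_of_le had]
  have hn : 0 ≤ ∫ x in a..d, g x ^ 2 := intervalIntegral.integral_nonneg had (fun _ _ => sq_nonneg _)
  calc ∫ x in a..d, f x ^ 2 ≤ ∫ x in a..d, (x - a) * ∫ y in a..d, g y ^ 2 := by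
        apply intervalIntegral.integral_mono_on had
        · apply Continuous.intervalIntegrable; fun_prop
        · apply Continuous.intervalIntegrable; fun_prop
        · intro x hx
          rcases hx.1.eq_or_lt with h | h
          · subst h; simp [ha]
          · refine (aux_cs f g hg hf a x h ha).trans ?_
            apply mul_le_mul_of_nonneg_left _ (by linarith)
            apply intervalIntegral.integral_mono_interval le_rfl h.le hx.2
            · exact Filter.Eventually.of_forall fun _ => sq_nonneg _
            · apply Continuous.intervalIntegrable; fun_prop
    _ = (d - a)^2 / 2 * ∫ y in a..d, g y ^ 2 := by
        rw [intervalIntegral.integral_mul_const]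
        congr 1
        rw [intervalIntegral.integral_sub (by apply Continuous.intervalIntegrable; fun_prop) (by simp)]
        simp; ring
    _ ≤ _ := by
        apply mul_le_mul_of_nonneg_right _ hn
        have : (d - a)^2 ≤ c^2 := by apply pow_le_pow_left₀ <;> linarith
        linarith

theorem aux_union (f g : ℝ → ℝ) (hg : Continuous g) (hf : ∀ x, HasDerivAt f (g x) x) (c : ℝ) (hc : 0 < c)
    (S : Finset ℝ) : (∀ s ∈ S, f s = 0) → ∀ b : ℝ,
    IntegrableOn (fun x => f x ^ 2) ((⋃ s ∈ S, Set.Ioc s (s + c)) ∩ Set.Iic b) ∧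
    IntegrableOn (fun x => g x ^ 2) ((⋃ s ∈ S, Set.Ioc s (s + c)) ∩ Set.Iic b) ∧
    ∫ x in (⋃ s ∈ S, Set.Ioc s (s + c)) ∩ Set.Iic b, f x ^ 2 ≤
      c^2 / 2 * ∫ x in (⋃ s ∈ S, Set.Ioc s (s + c)) ∩ Set.Iic b, g x ^ 2 := by
  have hfc : Continuous f := continuous_iff_continuousAt.2 fun x => (hf x).continuousAt
  induction S using Finset.induction_on_max with
  | empty => intro _ b; simp
  | insert a S hlt ih =>
    intro hS b
    have ih := ih (fun s hs => hS s (Finset.mem_insert_of_mem hs))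
    rcases le_or_gt b a with hb | hb
    · have : (⋃ s ∈ insert a S, Set.Ioc s (s + c)) ∩ Set.Iic b = (⋃ s ∈ S, Set.Ioc s (s + c)) ∩ Set.Iic b := by
        ext x
        simp only [Finset.mem_insert, Set.iUnion_iUnion_eq_or_left, Set.mem_inter_iff, Set.mem_union, Set.mem_Ioc,
          Set.mem_iUnion, Set.mem_Iic]
        constructor
        · rintro ⟨h | h, h'⟩
          · linarith [h.1]
          · exact ⟨h, h'⟩
        · rintro ⟨h, h'⟩; exact ⟨Or.inr h, h'⟩
      rw [this]; exact ih b
    · have : (⋃ s ∈ insert a S, Set.Ioc s (s + c)) ∩ Set.Iic b =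
          ((⋃ s ∈ S, Set.Ioc s (s + c)) ∩ Set.Iic a) ∪ Set.Ioc a (min (a + c) b) := by
        ext x
        simp only [Finset.mem_insert, Set.iUnion_iUnion_eq_or_left, Set.mem_inter_iff, Set.mem_union, Set.mem_Ioc,
          Set.mem_iUnion, Set.mem_Iic, le_min_iff]
        constructor
        · rintro ⟨h | ⟨s, hs, h⟩, h'⟩
          · exact Or.inr ⟨h.1, h.2, h'⟩
          · rcases le_or_gt x a with hx | hx
            · exact Or.inl ⟨⟨s, hs, h⟩, hx⟩
            · exact Or.inr ⟨hx, by linarith [hlt s hs, h.2], h'⟩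
        · rintro (⟨h, h'⟩ | h)
          · exact ⟨Or.inr h, by linarith⟩
          · exact ⟨Or.inl ⟨h.1, h.2.1⟩, h.2.2⟩
      rw [this]
      obtain ⟨i1, i2, i3⟩ := ih a
      have dj : Disjoint ((⋃ s ∈ S, Set.Ioc s (s + c)) ∩ Set.Iic a) (Set.Ioc a (min (a + c) b)) := by
        rw [Set.disjoint_left]
        rintro x ⟨_, h⟩ h2
        exact absurd h2.1 (not_lt.2 h)
      have j1 : IntegrableOn (fun x => f x ^ 2) (Set.Ioc a (min (a + c) b)) :=
        (Continuous.integrableOn_Ioc (by fun_prop))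
      have j2 : IntegrableOn (fun x => g x ^ 2) (Set.Ioc a (min (a + c) b)) :=
        (Continuous.integrableOn_Ioc (by fun_prop))
      refine ⟨i1.union j1, i2.union j2, ?_⟩
      rw [setIntegral_union dj measurableSet_Ioc i1 j1, setIntegral_union dj measurableSet_Ioc i2 j2, mul_add]
      apply add_le_add i3
      exact aux_poinc f g hg hf a _ c (le_min (by linarith) hb.le) (min_le_left _ _) (hS a (Finset.mem_insert_self _ _))

theorem aux_h (c : ℝ) (hc : 0 < c) : Integrable ((Set.Ioc (-c) c).indicator (fun t : ℝ => |t|)) ∧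
    ∫ t, (Set.Ioc (-c) c).indicator (fun t : ℝ => |t|) t = c ^ 2 := by
  constructor
  · rw [integrable_indicator_iff measurableSet_Ioc]
    exact continuous_abs.integrableOn_Ioc
  · rw [integral_indicator measurableSet_Ioc, ← intervalIntegral.integral_of_le (by linarith),
      ← intervalIntegral.integral_add_adjacent_intervals (b := 0) (continuous_abs.intervalIntegrable _ _) (continuous_abs.intervalIntegrable _ _)]
    have h1 : ∫ x in (-c)..0, |x| = ∫ x in (-c)..0, -x := by
      apply intervalIntegral.integral_congr
      intro x hx
      rw [Set.uIcc_of_le (by linarith)] at hx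
      exact abs_of_nonpos hx.2
    have h2 : ∫ x in 0..c, |x| = ∫ x in 0..c, x := by
      apply intervalIntegral.integral_congr
      intro x hx
      rw [Set.uIcc_of_le (by linarith)] at hx
      exact abs_of_nonneg hx.1
    rw [h1, h2, intervalIntegral.integral_neg]; simp; ring

theorem aux_double (F : ℝ → ℝ) (c : ℝ) (hc : 0 < c) (U : Set ℝ) (hU : MeasurableSet U)
    (hi : IntegrableOn (fun x => F x ^ 2) U) (B : Set (ℝ × ℝ)) (hBm : MeasurableSet B)
    (hB : ∀ p ∈ B, p.1 ∈ U ∧ p.2 ∈ U ∧ |p.1 - p.2| < c) :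
    (∫ p in B, |p.1 - p.2| * |F p.1| * |F p.2|) ≤ c ^ 2 * ∫ x in U, F x ^ 2 := by
  obtain ⟨hh, hhi⟩ := aux_h c hc
  set h := (Set.Ioc (-c) c).indicator (fun t : ℝ => |t|) with hdef
  set g := U.indicator (fun x => F x ^ 2) with gdef
  have hgi : Integrable g := (integrable_indicator_iff hU).2 hi
  have hg0 : ∀ x, 0 ≤ g x := fun x => Set.indicator_nonneg (fun _ _ => sq_nonneg _) x
  have hh0 : ∀ x, 0 ≤ h x := fun x => Set.indicator_nonneg (fun _ _ => abs_nonneg _) x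
  let G : ℝ × ℝ → ℝ := fun p => g p.2 * h (p.1 - p.2)
  have hG : Integrable G (volume.prod volume) :=
    hgi.convolution_integrand (ContinuousLinearMap.mul ℝ ℝ) hh
  have hGi : ∫ p, G p ∂(volume.prod volume) = c ^ 2 * ∫ x in U, F x ^ 2 := by
    rw [integral_prod_symm _ hG]
    simp only [G]
    simp_rw [integral_const_mul, integral_sub_right_eq_self h, hhi]
    rw [integral_mul_const, gdef, integral_indicator hU, mul_comm]
  have hGs : ∫ p, G p.swap ∂(volume.prod volume) = c ^ 2 * ∫ x in U, F x ^ 2 := by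
    rw [integral_prod_swap, hGi]
  have hG2 : Integrable (fun p => G p.swap) (volume.prod volume) := hG.swap
  have key : (∫ p in B, |p.1 - p.2| * |F p.1| * |F p.2|) ≤
      ∫ p : ℝ × ℝ, (G p + G p.swap) / 2 ∂(volume.prod volume) := by
    rw [← integral_indicator hBm]
    apply integral_mono_of_nonneg
    · refine Filter.Eventually.of_forall fun p => ?_
      exact Set.indicator_nonneg (fun _ _ => by positivity) p
    · exact (hG.add hG2).div_const 2
    · refine Filter.Eventually.of_forall fun p => ?_
      by_cases hp : p ∈ B
      · obtain ⟨h1, h2, h3⟩ := hB p hp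
        have h4 : |p.2 - p.1| < c := by rwa [abs_sub_comm]
        have m1 : p.1 - p.2 ∈ Set.Ioc (-c) c := ⟨(abs_lt.1 h3).1, (abs_lt.1 h3).2.le⟩
        have m2 : p.2 - p.1 ∈ Set.Ioc (-c) c := ⟨(abs_lt.1 h4).1, (abs_lt.1 h4).2.le⟩
        simp only [Set.indicator_of_mem hp, G, Prod.fst_swap, Prod.snd_swap, gdef, hdef,
          Set.indicator_of_mem h1, Set.indicator_of_mem h2, Set.indicator_of_mem m1,
          Set.indicator_of_mem m2]
        rw [abs_sub_comm p.2 p.1, ← sq_abs (F p.1), ← sq_abs (F p.2)]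
        nlinarith [mul_nonneg (abs_nonneg (p.1 - p.2)) (sq_nonneg (|F p.1| - |F p.2|))]
      · simp only [Set.indicator_of_notMem hp]
        have := mul_nonneg (hg0 p.2) (hh0 (p.1 - p.2))
        have := mul_nonneg (hg0 p.1) (hh0 (p.2 - p.1))
        simp only [G, Prod.fst_swap, Prod.snd_swap]
        linarith
  refine key.trans (le_of_eq ?_)
  rw [integral_div, integral_add hG hG2, hGi, hGs]
  ring

/-- for `F(x) = e^{-x²/2} ∏_{j=1}^m (x - λ_j)` with `m < n`, `0 < 2nc² < 1` and
`B = ∪_i (λ_i, λ_i+c)² ⊂ ℝ²`, `∫_B |x₁-x₂||F(x₁)||F(x₂)| ≤ n c⁴ ∫ |F|²`. -/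
theorem stmt13 (m n : ℕ) (hm : 0 < m) (hmn : m < n) (lam : Fin m → ℝ)
    (c : ℝ) (hc : 0 < c) (hnc : 2 * n * c ^ 2 < 1)
    (F : ℝ → ℝ) (hF : F = fun x => Real.exp (-x ^ 2 / 2) * ∏ j, (x - lam j))
    (B : Set (ℝ × ℝ))
    (hB : B = ⋃ i : Fin m, (Set.Ioo (lam i) (lam i + c)) ×ˢ (Set.Ioo (lam i) (lam i + c))) :
    (∫ p in B, |p.1 - p.2| * |F p.1| * |F p.2|) ≤ n * c ^ 4 * ∫ x : ℝ, (F x) ^ 2 := by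
  classical
  let P : Polynomial ℝ := ∏ j, (Polynomial.X - Polynomial.C (lam j))
  let R : Polynomial ℝ := Polynomial.derivative P + Polynomial.C (-1) * (Polynomial.X * P)
  let g : ℝ → ℝ := fun x => Real.exp (-x ^ 2 / 2) * R.eval x
  have hFP : ∀ x, F x = Real.exp (-x ^ 2 / 2) * P.eval x := by
    intro x; rw [hF]; simp [P, Polynomial.eval_prod]
  have hdeg : P.natDegree ≤ m := by
    simp [P, Polynomial.natDegree_prod_of_monic _ _ (fun j _ => Polynomial.monic_X_sub_C (lam j))]
  have hex : ∀ x : ℝ, Real.exp (-x ^ 2 / 2) * Real.exp (-x ^ 2 / 2) = Real.exp (-x ^ 2) := by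
    intro x; rw [← Real.exp_add]; congr 1; ring
  have hg : Continuous g := by
    have := R.continuous
    fun_prop
  have hder : ∀ x, HasDerivAt F (g x) x := by
    intro x
    rw [funext hFP]
    have h2 : HasDerivAt (fun x : ℝ => Real.exp (-x ^ 2 / 2)) (Real.exp (-x ^ 2 / 2) * (-(2 * x) / 2)) x := by
      simpa using (((hasDerivAt_pow 2 x).neg).div_const 2).exp
    refine (h2.mul (P.hasDerivAt x)).congr_deriv ?_
    simp only [g, R, Polynomial.eval_add, Polynomial.eval_mul, Polynomial.eval_C, Polynomial.eval_X]; ring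
  have hF2 : ∀ x, F x ^ 2 = (P * P).eval x * Real.exp (-x ^ 2) := by
    intro x; rw [hFP, ← hex, Polynomial.eval_mul]; ring
  have hg2 : ∀ x, g x ^ 2 = (R * R).eval x * Real.exp (-x ^ 2) := by
    intro x; simp only [g]; rw [← hex, Polynomial.eval_mul]; ring
  have hmar : ∫ x, g x ^ 2 ≤ (2 * m + 1) * ∫ x, F x ^ 2 := by
    simp only [hF2, hg2]; exact aux_markov2 m P hdeg
  have hFi : Integrable (fun x => F x ^ 2) := by simp only [hF2]; exact aux_int _
  have hgi : Integrable (fun x => g x ^ 2) := by simp only [hg2]; exact aux_int _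
  let S : Finset ℝ := Finset.univ.image lam
  have hS : ∀ s ∈ S, F s = 0 := by
    intro s hs
    obtain ⟨j, -, rfl⟩ := Finset.mem_image.1 hs
    rw [hF]
    simp only [mul_eq_zero]
    exact Or.inr (Finset.prod_eq_zero (Finset.mem_univ j) (sub_self _))
  obtain ⟨b, hb⟩ := (S.image (fun s => s + c)).bddAbove
  let U := (⋃ s ∈ S, Set.Ioc s (s + c)) ∩ Set.Iic b
  have hUm : MeasurableSet U :=
    (Finset.measurableSet_biUnion _ fun _ _ => measurableSet_Ioc).inter measurableSet_Iic
  have hU : ∫ x in U, F x ^ 2 ≤ c ^ 2 / 2 * ∫ x in U, g x ^ 2 :=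
    (aux_union F g hg hder c hc S hS b).2.2
  have hUg : ∫ x in U, g x ^ 2 ≤ ∫ x, g x ^ 2 :=
    setIntegral_le_integral hgi (Filter.Eventually.of_forall fun _ => sq_nonneg _)
  have hBm : MeasurableSet B := by
    rw [hB]
    exact MeasurableSet.iUnion fun i => measurableSet_Ioo.prod measurableSet_Ioo
  have hmem : ∀ i x, x ∈ Set.Ioo (lam i) (lam i + c) → x ∈ U := by
    intro i x hx
    have hi : lam i ∈ S := Finset.mem_image_of_mem _ (Finset.mem_univ i)
    refine ⟨Set.mem_biUnion hi ⟨hx.1, hx.2.le⟩, ?_⟩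
    have : lam i + c ≤ b := hb (Finset.mem_coe.2 (Finset.mem_image_of_mem (fun s => s + c) hi))
    exact hx.2.le.trans this
  have hBU : ∀ p ∈ B, p.1 ∈ U ∧ p.2 ∈ U ∧ |p.1 - p.2| < c := by
    intro p hp
    rw [hB] at hp
    obtain ⟨i, h1, h2⟩ := Set.mem_iUnion.1 hp
    refine ⟨hmem i _ h1, hmem i _ h2, ?_⟩
    rw [abs_lt]
    constructor <;> linarith [h1.1, h1.2, h2.1, h2.2]
  have hd := aux_double F c hc U hUm hFi.integrableOn B hBm hBU
  have hF0 : 0 ≤ ∫ x, F x ^ 2 := integral_nonneg fun _ => sq_nonneg _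
  have hn : (2 * m + 1 : ℝ) ≤ 2 * n := by
    have : (m : ℝ) + 1 ≤ n := by exact_mod_cast hmn
    linarith
  calc _ ≤ c ^ 2 * ∫ x in U, F x ^ 2 := hd
    _ ≤ c ^ 2 * (c ^ 2 / 2 * (2 * n * ∫ x, F x ^ 2)) := by
        apply mul_le_mul_of_nonneg_left _ (sq_nonneg c)
        refine hU.trans (mul_le_mul_of_nonneg_left ?_ (by positivity))
        exact (hUg.trans hmar).trans (mul_le_mul_of_nonneg_right hn hF0)
    _ = _ := by ring
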